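/- For every t = 0,…,T−1 and every x ∈ ℝ, one has H_t(x) − H*_t(x) ≤ ω_t(x) and V_t(x) − V*_t(x) ≤ ω̄_t(x). -/

import Mathlib

open MeasureTheory Filter Set

/-- Round a demand down to the left end point of its cell `(z_n, z_{n+1}]`. -/
noncomputable def rdn (θ ξ : ℝ) : ℝ := ((⌈ξ / θ⌉₊ : ℝ) - 1) * θ

def EvConst (g : ℝ → ℝ) : Prop := ∃ b c : ℝ, ∀ x < b, g x = c

def OnGrid (θ x : ℝ) : Prop := ∃ m : ℤ, x = (m : ℝ) * θ

lemma down_ind {T : ℕ} (hT : 2 ≤ T) (P : ℕ → Prop) (h1 : P (T - 1))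
    (h2 : ∀ t, t + 2 ≤ T → P (t + 1) → P t) : ∀ t, t < T → P t := by
  have key : ∀ k t, t + k + 1 = T → P t := by
    intro k
    induction k with
    | zero => intro t ht; have : t = T - 1 := by omega
              rw [this]; exact h1
    | succ k ih => intro t ht; exact h2 t (by omega) (ih (t + 1) (by omega))
  intro t ht
  exact key (T - 1 - t) t (by omega)

lemma rdn_lt {θ ξ : ℝ} (hθ : 0 < θ) (hξ : 0 ≤ ξ) : rdn θ ξ < ξ := by
  unfold rdn
  have h := Nat.ceil_lt_add_one (div_nonneg hξ hθ.le)
  have : ((⌈ξ / θ⌉₊ : ℝ) - 1) < ξ / θ := by linarith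
  rwa [lt_div_iff₀ hθ] at this

lemma le_rdn {θ ξ : ℝ} (hθ : 0 < θ) : ξ ≤ rdn θ ξ + θ := by
  unfold rdn
  have h := Nat.le_ceil (ξ / θ)
  rw [div_le_iff₀ hθ] at h
  linarith

lemma neg_le_rdn {θ ξ : ℝ} (hθ : 0 < θ) : -θ ≤ rdn θ ξ := by
  unfold rdn
  have : (0 : ℝ) ≤ (⌈ξ / θ⌉₊ : ℝ) := Nat.cast_nonneg _
  nlinarith

lemma OnGrid.sub_rdn {θ x : ℝ} (h : OnGrid θ x) (ξ : ℝ) : OnGrid θ (x - rdn θ ξ) := by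
  obtain ⟨m, rfl⟩ := h
  refine ⟨m - ((⌈ξ / θ⌉₊ : ℤ) - 1), ?_⟩
  unfold rdn
  push_cast
  ring

lemma OnGrid.add_le {θ x y : ℝ} (hθ : 0 < θ) (hx : OnGrid θ x) (hy : OnGrid θ y) (h : x < y) :
    x + θ ≤ y := by
  obtain ⟨m, rfl⟩ := hx
  obtain ⟨n, rfl⟩ := hy
  have h1 : (m : ℝ) < n := lt_of_mul_lt_mul_right h hθ.le
  have h2 : m + 1 ≤ n := by exact_mod_cast h1
  have h3 : (m : ℝ) + 1 ≤ n := by exact_mod_cast h2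
  nlinarith

lemma exists_grid_floor {θ : ℝ} (hθ : 0 < θ) (x : ℝ) : ∃ g, OnGrid θ g ∧ g ≤ x ∧ x < g + θ := by
  refine ⟨(⌊x / θ⌋ : ℝ) * θ, ⟨_, rfl⟩, ?_, ?_⟩
  · rw [← le_div_iff₀ hθ]; exact Int.floor_le _
  · have := Int.lt_floor_add_one (x / θ)
    rw [div_lt_iff₀ hθ] at this
    linarith

lemma evConst_integrable (ν : Measure ℝ) [IsProbabilityMeasure ν] {θ : ℝ} (hθ : 0 < θ)
    {g : ℝ → ℝ} (hg : EvConst g) (y : ℝ) :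
    Integrable (fun ξ => g (y - rdn θ ξ)) ν ∧
    Integrable (fun n : ℕ => g (y - ((n : ℝ) - 1) * θ)) (ν.map (fun ξ => ⌈ξ / θ⌉₊)) := by
  obtain ⟨b, c, hb⟩ := hg
  have hm : Measurable (fun ξ : ℝ => ⌈ξ / θ⌉₊) := Nat.measurable_ceil.comp (measurable_id.div_const θ)
  have hP : IsProbabilityMeasure (ν.map (fun ξ => ⌈ξ / θ⌉₊)) :=
    Measure.isProbabilityMeasure_map hm.aemeasurable
  have h2 : Integrable (fun n : ℕ => g (y - ((n : ℝ) - 1) * θ)) (ν.map (fun ξ => ⌈ξ / θ⌉₊)) := by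
    obtain ⟨N, hN⟩ := exists_nat_gt ((y - b) / θ + 1)
    have hbd : ∀ n : ℕ, ‖g (y - ((n : ℝ) - 1) * θ)‖ ≤
        |c| + ∑ i ∈ Finset.range N, |g (y - ((i : ℝ) - 1) * θ)| := by
      intro n
      rw [Real.norm_eq_abs]
      by_cases hn : n < N
      · have := Finset.single_le_sum (f := fun i : ℕ => |g (y - ((i : ℝ) - 1) * θ)|)
          (fun i _ => abs_nonneg _) (Finset.mem_range.2 hn)
        have h0 := abs_nonneg c

        linarith
      · have h0 : 0 ≤ ∑ i ∈ Finset.range N, |g (y - ((i : ℝ) - 1) * θ)| :=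
          Finset.sum_nonneg (fun i _ => abs_nonneg _)
        have hn' : (N : ℝ) ≤ n := by exact_mod_cast not_lt.1 hn
        have h3 : (y - b) / θ < (n : ℝ) - 1 := by linarith
        rw [div_lt_iff₀ hθ] at h3
        rw [hb _ (by linarith)]
        linarith
    exact Integrable.of_bound (measurable_of_countable _).aestronglyMeasurable _
      (ae_of_all _ hbd)
  exact ⟨h2.comp_measurable hm, h2⟩

lemma integral_rdn (ν : Measure ℝ) [IsProbabilityMeasure ν] (hpos : ν (Set.Iio 0) = 0)
    {θ : ℝ} (hθ : 0 < θ) (F : ℝ → ℝ) (hF : ∀ x, F x = (ν (Set.Iic x)).toReal)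
    (f : ℤ → ℝ) (hf : ∀ n : ℤ, f n = F (((n : ℝ) + 1) * θ) - F ((n : ℝ) * θ))
    {g : ℝ → ℝ} (hg : EvConst g) (y : ℝ) :
    ∫ ξ, g (y - rdn θ ξ) ∂ν = ∑' n : ℕ, g (y - ((n : ℝ) - 1) * θ) * f ((n : ℤ) - 1) := by
  have hm : Measurable (fun ξ : ℝ => ⌈ξ / θ⌉₊) := Nat.measurable_ceil.comp (measurable_id.div_const θ)
  have h2 := (evConst_integrable ν hθ hg y).2
  have h3 : ∫ ξ, g (y - rdn θ ξ) ∂ν =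
      ∫ n : ℕ, g (y - ((n : ℝ) - 1) * θ) ∂(ν.map (fun ξ => ⌈ξ / θ⌉₊)) := by
    rw [integral_map hm.aemeasurable (measurable_of_countable _).aestronglyMeasurable]
    rfl
  rw [h3, integral_countable h2]
  congr 1
  ext n
  rw [smul_eq_mul, mul_comm]
  congr 1
  rw [Measure.real, Measure.map_apply hm (measurableSet_singleton n), hf, hF, hF]
  have e : (ν ((fun ξ : ℝ => ⌈ξ / θ⌉₊) ⁻¹' {n})) =
      ν (Set.Ioc ((((n : ℤ) - 1 : ℤ) : ℝ) * θ) (((((n : ℤ) - 1 : ℤ) : ℝ) + 1) * θ)) := by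
    apply measure_congr
    have hae : ∀ᵐ ξ ∂ν, 0 ≤ ξ := by
      rw [ae_iff]; simpa [Set.Iio] using hpos
    filter_upwards [hae] with ξ hξ
    apply propext
    change ⌈ξ / θ⌉₊ = n ↔ ξ ∈ Set.Ioc _ _
    have a1 := rdn_lt hθ hξ
    have a2 := le_rdn (ξ := ξ) hθ
    unfold rdn at a1 a2
    rw [Set.mem_Ioc]
    push_cast
    constructor
    · rintro rfl
      exact ⟨a1, by linarith⟩
    · rintro ⟨b1, b2⟩
      have c1 : ((⌈ξ / θ⌉₊ : ℝ) - 1) < n := lt_of_mul_lt_mul_right (by linarith) hθ.le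
      have c2 : (n : ℝ) - 1 < ⌈ξ / θ⌉₊ := lt_of_mul_lt_mul_right (by linarith) hθ.le
      have d1 : ⌈ξ / θ⌉₊ < n + 1 := by
        have : (⌈ξ / θ⌉₊ : ℝ) < n + 1 := by linarith
        exact_mod_cast this
      have d2 : n < ⌈ξ / θ⌉₊ + 1 := by
        have : (n : ℝ) < ⌈ξ / θ⌉₊ + 1 := by linarith
        exact_mod_cast this
      omega
  rw [e, show ∀ a b : ℝ, Set.Ioc a b = Set.Iic b \ Set.Iic a from fun a b => by ext; simp [and_comm], measure_sdiff (Set.Iic_subset_Iic.2 (by nlinarith))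
    measurableSet_Iic.nullMeasurableSet (measure_ne_top _ _),
    ENNReal.toReal_sub_of_le (measure_mono (Set.Iic_subset_Iic.2 (by nlinarith))) (measure_ne_top _ _)]

lemma psi_eq (ν : Measure ℝ) [IsProbabilityMeasure ν] (hpos : ν (Set.Iio 0) = 0)
    {θ : ℝ} (hθ : 0 < θ) (F : ℝ → ℝ) (hF : ∀ x, F x = (ν (Set.Iic x)).toReal)
    (f : ℤ → ℝ) (hf : ∀ n : ℤ, f n = F (((n : ℝ) + 1) * θ) - F ((n : ℝ) * θ))
    (φ : ℝ → ℝ) (s a α y p : ℝ) (hz : ∀ y < s, φ y = 0)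
    (hA : y < s - θ → p = a)
    (hB : s - θ ≤ y → ∀ n : ℤ, ((n : ℝ) - 1) * θ ≤ y - s → y - s < (n : ℝ) * θ →
      p = a + α * ∑ j ∈ Finset.Icc (-1 : ℤ) (n - 1), φ (y - (j : ℝ) * θ) * f j) :
    p = a + α * ∫ ξ, φ (y - rdn θ ξ) ∂ν := by
  by_cases h : y < s - θ
  · have : ∀ ξ, φ (y - rdn θ ξ) = 0 := fun ξ => hz _ (by have := neg_le_rdn (ξ := ξ) hθ; linarith)
    simp [hA h, this]
  · push Not at h
    rw [integral_rdn ν hpos hθ F hF f hf ⟨s, 0, hz⟩ y]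
    obtain ⟨g, ⟨m, rfl⟩, h1, h2⟩ := exists_grid_floor hθ (y - s)
    have hm : (-1 : ℝ) < m + 1 := lt_of_mul_lt_mul_right (by linarith : -1 * θ < (m + 1) * θ) hθ.le
    have hm' : -1 < m + 1 := by exact_mod_cast hm
    rw [hB h (m + 1) (by push_cast; linarith) (by push_cast; linarith)]
    congr 2
    rw [tsum_eq_sum (s := Finset.range (m + 2).toNat)]
    · refine Finset.sum_nbij' (fun j => (j + 1).toNat) (fun n => (n : ℤ) - 1) ?_ ?_ ?_ ?_ ?_
      · intro j hj; simp at hj ⊢; omega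
      · intro j hj; simp at hj ⊢; omega
      · intro j hj; simp at hj ⊢; omega
      · intro j hj; simp at hj ⊢
      · intro j hj
        simp at hj
        have e : ((j + 1).toNat : ℤ) = j + 1 := Int.toNat_of_nonneg (by omega)
        have e' : (((j + 1).toNat : ℕ) : ℝ) = j + 1 := by exact_mod_cast e
        rw [e, e']; simp
    · intro n hn
      simp at hn
      have : (m : ℝ) + 2 ≤ n := by exact_mod_cast hn
      rw [hz _ (by nlinarith), zero_mul]

/-- Regularity of the optimal value functions. -/
def VOK (v : ℝ → ℝ) : Prop :=
  Measurable v ∧ (∃ c, ∀ x, c ≤ v x) ∧ ∀ X, ∃ B, ∀ x ≤ X, v x ≤ B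

lemma ae_nonneg_of {ν : Measure ℝ} (hpos : ν (Set.Iio 0) = 0) : ∀ᵐ ξ ∂ν, 0 ≤ ξ := by
  rw [ae_iff]; simpa [Set.Iio] using hpos

lemma VOK.integrable {v : ℝ → ℝ} (hv : VOK v) (ν : Measure ℝ) [IsProbabilityMeasure ν]
    (hpos : ν (Set.Iio 0) = 0) (y : ℝ) : Integrable (fun ξ => v (y - ξ)) ν := by
  obtain ⟨hm, ⟨c, hc⟩, hB⟩ := hv
  obtain ⟨B, hB⟩ := hB y
  refine Integrable.of_bound (hm.comp (measurable_const.sub measurable_id)).aestronglyMeasurable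
    (max |c| |B|) ?_
  filter_upwards [ae_nonneg_of hpos] with ξ hξ
  rw [Real.norm_eq_abs]
  exact abs_le_max_abs_abs (hc _) (hB _ (by linarith))

lemma VOK.step {v H V C : ℝ → ℝ} (hv : VOK v) (ν : Measure ℝ) [IsProbabilityMeasure ν]
    (hpos : ν (Set.Iio 0) = 0) {α K : ℝ} (hα : 0 < α) (hK : 0 ≤ K)
    (hCm : Measurable C) (hCb : ∃ c, ∀ x, c ≤ C x)
    (hH : ∀ y, H y = C y + α * ∫ ξ, v (y - ξ) ∂ν)
    (hV : ∀ x, V x = sInf ((fun y => K * (if x < y then (1 : ℝ) else 0) + H y) '' Set.Ici x)) :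
    VOK V ∧ (∀ x y, x < y → V x ≤ K + V y) := by
  have hint := hv.integrable ν hpos
  obtain ⟨cC, hcC⟩ := hCb
  obtain ⟨hm, ⟨c, hc⟩, hB⟩ := hv
  have hHb : ∀ y, cC + α * c ≤ H y := by
    intro y
    have h1 : ∫ _, c ∂ν ≤ ∫ ξ, v (y - ξ) ∂ν := integral_mono (integrable_const c) (hint y) (fun ξ => hc _)
    simp at h1
    rw [hH]
    have := hcC y
    nlinarith
  have hHm : Measurable H := by
    have e : H = fun y => C y + α * ∫ ξ, v (y - ξ) ∂ν := funext hH
    rw [e]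
    have h1 : StronglyMeasurable (fun p : ℝ × ℝ => v (p.1 - p.2)) :=
      (hm.comp (measurable_fst.sub measurable_snd)).stronglyMeasurable
    have h2 : StronglyMeasurable (fun y => ∫ ξ, v (y - ξ) ∂ν) := h1.integral_prod_right'
    exact hCm.add (h2.measurable.const_mul α)
  have hpen : ∀ x y : ℝ, 0 ≤ K * (if x < y then (1 : ℝ) else 0) := by
    intro x y; split_ifs <;> simp [hK]
  have hpen' : ∀ x y : ℝ, K * (if x < y then (1 : ℝ) else 0) ≤ K := by
    intro x y; split_ifs <;> simp [hK]
  have hbdd : ∀ x, BddBelow ((fun y => K * (if x < y then (1 : ℝ) else 0) + H y) '' Set.Ici x) := by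
    intro x
    refine ⟨cC + α * c, ?_⟩
    rintro _ ⟨y, _, rfl⟩
    have := hpen x y
    have := hHb y
    simp only
    linarith
  have hne : ∀ x, ((fun y => K * (if x < y then (1 : ℝ) else 0) + H y) '' Set.Ici x).Nonempty :=
    fun x => ⟨_, x, Set.self_mem_Ici, rfl⟩
  have hle : ∀ x y, x ≤ y → V x ≤ K * (if x < y then (1 : ℝ) else 0) + H y := by
    intro x y hxy
    rw [hV]
    exact csInf_le (hbdd x) ⟨y, hxy, rfl⟩
  have hge : ∀ x a, (∀ y, x ≤ y → a ≤ K * (if x < y then (1 : ℝ) else 0) + H y) → a ≤ V x := by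
    intro x a h
    rw [hV]
    refine le_csInf (hne x) ?_
    rintro _ ⟨y, hy, rfl⟩
    exact h y hy
  have hbdd2 : ∀ x, BddBelow (H '' Set.Ici x) := by
    intro x
    refine ⟨cC + α * c, ?_⟩
    rintro _ ⟨y, _, rfl⟩
    exact hHb y
  have hmono : Monotone (fun x => sInf (H '' Set.Ici x)) := by
    intro x y hxy
    exact csInf_le_csInf (hbdd2 x) ⟨_, y, Set.self_mem_Ici, rfl⟩
      (Set.image_mono (Set.Ici_subset_Ici.2 hxy))
  have hVeq : V = fun x => min (H x) (K + sInf (H '' Set.Ici x)) := by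
    funext x
    apply le_antisymm
    · refine le_min ?_ ?_
      · simpa using hle x x le_rfl
      · have : V x - K ≤ sInf (H '' Set.Ici x) := by
          refine le_csInf ⟨_, x, Set.self_mem_Ici, rfl⟩ ?_
          rintro _ ⟨y, hy, rfl⟩
          have := hle x y hy
          have := hpen' x y
          linarith
        linarith
    · refine hge _ _ fun y hy => ?_
      rcases eq_or_lt_of_le (show x ≤ y from hy) with h | h
      · subst h; simp
      · simp only [h, if_true, mul_one]
        refine (min_le_right _ _).trans ?_
        have := csInf_le (hbdd2 x) ⟨y, hy, rfl⟩
        linarith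
  refine ⟨⟨?_, ⟨cC + α * c, fun x => hge _ _ fun y _ => ?_⟩, fun X => ⟨K + H X, fun x hx => ?_⟩⟩, ?_⟩
  · rw [hVeq]; exact hHm.min (measurable_const.add hmono.measurable)
  · have := hpen x y
    have := hHb y
    linarith
  · have := hle x X hx
    have := hpen' x X
    linarith
  · intro x y hxy
    have : V x - K ≤ V y := by
      refine hge _ _ fun z hz => ?_
      have := hle x z (by linarith)
      have := hpen' x z
      have := hpen y z
      linarith
    linarith

def KConv (P : ℝ → Prop) (K : ℝ) (h : ℝ → ℝ) : Prop :=
  ∀ x w y, P x → P w → P y → x < w → w < y →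
    (w - x) * h w + (y - w) * (h w - h x) ≤ (w - x) * (K + h y)

structure Good (P : ℝ → Prop) (K : ℝ) (h : ℝ → ℝ) (s S : ℝ) : Prop where
  K0 : 0 ≤ K
  conv : KConv P K h
  min : ∀ z, P z → h S ≤ h z
  hs : h s ≤ h S + K
  below : ∀ z, P z → z < s → h S + K ≤ h z
  Ps : P s

lemma Good.c {P K h s S} (hg : Good P K h s S) {z w : ℝ} (hz : P z) (hw : P w) (hsz : s ≤ z)
    (hzw : z ≤ w) : h z ≤ h w + K := by
  rcases eq_or_lt_of_le hzw with h1 | h1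
  · subst h1; linarith [hg.K0]
  have h3 := hg.min w hw
  have h4 := hg.hs
  rcases eq_or_lt_of_le hsz with h2 | h2
  · subst h2; linarith
  · by_contra hc
    push Not at hc
    have := hg.conv s z w hg.Ps hz hw h2 h1
    have a : 0 < z - s := by linarith
    have b : 0 < w - z := by linarith
    nlinarith [mul_pos a (by linarith : 0 < h z - (h w + K)),
      mul_pos b (by linarith : 0 < h z - h s)]

lemma Good.Vmin {P K h s S} (hg : Good P K h s S) {V : ℝ → ℝ}
    (hV : ∀ y, V y = if y < s then h S + K else h y) {y : ℝ} (hy : P y) : h S ≤ V y := by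
  rw [hV]; split_ifs
  · linarith [hg.K0]
  · exact hg.min y hy

lemma Good.Vle {P K h s S} (hg : Good P K h s S) {V : ℝ → ℝ}
    (hV : ∀ y, V y = if y < s then h S + K else h y) {x y : ℝ} (hx : P x) (hy : P y)
    (hxy : x ≤ y) : V x ≤ V y + K := by
  by_cases h1 : x < s
  · have := hg.Vmin hV hy
    rw [hV x, if_pos h1]; linarith
  · rw [hV x, if_neg h1, hV y, if_neg (by linarith)]
    exact hg.c hx hy (by linarith) hxy

lemma Good.Vconv {P K h s S} (hg : Good P K h s S) {V : ℝ → ℝ}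
    (hV : ∀ y, V y = if y < s then h S + K else h y) : KConv P K V := by
  intro x w y hx hw hy hxw hwy
  have hK := hg.K0
  have a : 0 < w - x := by linarith
  have b : 0 < y - w := by linarith
  have hy' := hg.Vmin hV hy
  by_cases h1 : w < s
  · rw [hV x, hV w, if_pos h1, if_pos (by linarith)]
    nlinarith
  · push Not at h1
    have eW : V w = h w := by rw [hV, if_neg (by linarith)]
    have eY : V y = h y := by rw [hV, if_neg (by linarith)]
    rw [eY] at hy'
    rw [eW, eY]
    by_cases h2 : x < s
    · rw [hV x, if_pos h2]
      have hs := hg.hs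
      by_cases h3 : h w ≤ h S + K
      · nlinarith [mul_nonneg b.le (by linarith : 0 ≤ h S + K - h w),
          mul_nonneg a.le (by linarith : 0 ≤ K + h y - h w)]
      · push Not at h3
        rcases eq_or_lt_of_le h1 with h4 | h4
        · subst h4; linarith
        · have h5 := hg.conv s w y hg.Ps hw hy h4 hwy
          have d : 0 < w - s := by linarith
          -- K + h y - h w is nonnegative
          have h6 : (y - w) * (h w - (h S + K)) ≤ (w - s) * (K + h y - h w) := by
            nlinarith [mul_nonneg b.le (by linarith : 0 ≤ h S + K - h s)]
          have h7 : 0 ≤ K + h y - h w := by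
            have : 0 < (w - s) * (K + h y - h w) :=
              lt_of_lt_of_le (mul_pos b (by linarith)) h6
            exact (pos_of_mul_pos_right this d.le).le
          nlinarith [mul_nonneg h7 (by linarith : 0 ≤ s - x)]
    · rw [hV x, if_neg h2]
      exact hg.conv x w y hx hw hy hxw hwy

lemma convex_three {C : ℝ → ℝ} (hC : ConvexOn ℝ Set.univ C) {x w y : ℝ} (h1 : x < w) (h2 : w < y) :
    (w - x) * C w + (y - w) * (C w - C x) ≤ (w - x) * C y := by
  have := hC.slope_mono_adjacent (Set.mem_univ x) (Set.mem_univ y) h1 h2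
  rw [div_le_div_iff₀ (by linarith) (by linarith)] at this
  nlinarith

lemma convex_anti {C : ℝ → ℝ} (hC : ConvexOn ℝ Set.univ C) {m : ℝ} (hm : ∀ y, C m ≤ C y)
    {x y : ℝ} (h1 : x ≤ y) (h2 : y ≤ m) : C y ≤ C x := by
  rcases eq_or_lt_of_le h1 with h | h
  · rw [h]
  rcases eq_or_lt_of_le h2 with h' | h'
  · rw [h']; exact hm x
  have := convex_three hC h h'
  have := hm y
  by_contra hc
  push Not at hc
  nlinarith [mul_pos (sub_pos.2 h') (sub_pos.2 hc), mul_nonneg (sub_pos.2 h).le (sub_nonneg.2 (hm y))]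

lemma convex_mono {C : ℝ → ℝ} (hC : ConvexOn ℝ Set.univ C) {m : ℝ} (hm : ∀ y, C m ≤ C y)
    {x y : ℝ} (h1 : x ≤ y) (h2 : m ≤ x) : C x ≤ C y := by
  rcases eq_or_lt_of_le h1 with h | h
  · rw [h]
  rcases eq_or_lt_of_le h2 with h' | h'
  · rw [← h']; exact hm y
  have := convex_three hC h' h
  nlinarith [mul_nonneg (sub_pos.2 h).le (sub_nonneg.2 (hm x)), sub_pos.2 h']

lemma KConv.step {P : ℝ → Prop} {θ : ℝ} (hθ : 0 < θ) (hP : ∀ x ξ, P x → P (x - rdn θ ξ))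
    {K K' α : ℝ} (hα : 0 < α) (hKK : α * K' ≤ K) {C v H : ℝ → ℝ} (hC : ConvexOn ℝ Set.univ C)
    (hv : KConv P K' v) (hE : EvConst v) (ν : Measure ℝ) [IsProbabilityMeasure ν]
    (hH : ∀ y, H y = C y + α * ∫ ξ, v (y - rdn θ ξ) ∂ν) : KConv P K H := by
  intro x w y hx hw hy hxw hwy
  have hi := fun y => (evConst_integrable ν hθ hE y).1
  have h1 : ∫ _, (-((w - x) * K')) ∂ν ≤ ∫ ξ, ((w - x) * v (y - rdn θ ξ) - (y - x) * v (w - rdn θ ξ)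
      + (y - w) * v (x - rdn θ ξ)) ∂ν := by
    refine integral_mono (integrable_const _)
      ((((hi y).const_mul _).sub ((hi w).const_mul _)).add ((hi x).const_mul _)) (fun ξ => ?_)
    have := hv _ _ _ (hP x ξ hx) (hP w ξ hw) (hP y ξ hy) (by linarith) (by linarith)
    simp only
    nlinarith
  rw [integral_add (f := fun ξ => (w - x) * v (y - rdn θ ξ) - (y - x) * v (w - rdn θ ξ))
      (((hi y).const_mul _).sub ((hi w).const_mul _)) ((hi x).const_mul _),
    integral_sub ((hi y).const_mul _) ((hi w).const_mul _), integral_const_mul, integral_const_mul,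
    integral_const_mul] at h1
  simp only [integral_const, probReal_univ, smul_eq_mul, one_mul] at h1
  have h2 := convex_three hC hxw hwy
  rw [hH x, hH w, hH y]
  have h3 := mul_le_mul_of_nonneg_left h1 hα.le
  have h4 := mul_le_mul_of_nonneg_left hKK (by linarith : 0 ≤ w - x)
  nlinarith

lemma int_le1 {ν : Measure ℝ} (hpos : ν (Set.Iio 0) = 0) {a b : ℝ → ℝ} (ha : Integrable a ν)
    (hb : Integrable b ν) (h : ∀ ξ, 0 ≤ ξ → a ξ ≤ b ξ) : ∫ ξ, a ξ ∂ν ≤ ∫ ξ, b ξ ∂ν := by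
  refine integral_mono_ae ha hb ?_
  filter_upwards [ae_nonneg_of hpos] with ξ hξ using h ξ hξ

lemma int_le2 {ν : Measure ℝ} (hpos : ν (Set.Iio 0) = 0) {a b c : ℝ → ℝ} (ha : Integrable a ν)
    (hb : Integrable b ν) (hc : Integrable c ν) (h : ∀ ξ, 0 ≤ ξ → a ξ ≤ b ξ + c ξ) :
    ∫ ξ, a ξ ∂ν ≤ ∫ ξ, b ξ ∂ν + ∫ ξ, c ξ ∂ν := by
  rw [← integral_add hb hc]
  exact int_le1 hpos ha (hb.add hc) h

lemma int_le3 {ν : Measure ℝ} (hpos : ν (Set.Iio 0) = 0) {a b c d : ℝ → ℝ} (ha : Integrable a ν)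
    (hb : Integrable b ν) (hc : Integrable c ν) (hd : Integrable d ν)
    (h : ∀ ξ, 0 ≤ ξ → a ξ ≤ b ξ + c ξ + d ξ) :
    ∫ ξ, a ξ ∂ν ≤ ∫ ξ, b ξ ∂ν + ∫ ξ, c ξ ∂ν + ∫ ξ, d ξ ∂ν := by
  rw [← integral_add hb hc]
  exact int_le2 (b := fun ξ => b ξ + c ξ) hpos ha (hb.add hc) hd h

structure DiffOK (φ : ℝ → ℝ → ℝ) (V : ℝ → ℝ) : Prop where
  nonneg : ∀ x y, 0 ≤ x → 0 ≤ φ x y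
  mono : ∀ x x' y y', 0 ≤ x → x ≤ x' → y ≤ y' → φ x y ≤ φ x' y'
  diff : ∀ x y, 0 ≤ x → V y - V (y - x) ≤ φ x y

structure BarOK (θ : ℝ) (φb : ℝ → ℝ) (V : ℝ → ℝ) (φ : ℝ → ℝ → ℝ) : Prop where
  nonneg : ∀ G, OnGrid θ G → 0 ≤ φb G
  mono : ∀ G G', OnGrid θ G → OnGrid θ G' → G ≤ G' → φb G ≤ φb G'
  ge : ∀ G, OnGrid θ G → φ θ G ≤ φb G
  diff : ∀ g y G, OnGrid θ g → OnGrid θ G → g ≤ y → y < g + θ → y ≤ G → V g - V y ≤ φb G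

section
variable {ν : Measure ℝ} [IsProbabilityMeasure ν] (hpos : ν (Set.Iio 0) = 0)
  {θ : ℝ} (hθ : 0 < θ) {α γ : ℝ} (hα : 0 < α) (hγ : 0 ≤ γ) {C V H : ℝ → ℝ}

lemma psi_diff' (hpos : ν (Set.Iio 0) = 0) (hθ : 0 < θ) (hα : 0 < α)
    {φ ψ : ℝ → ℝ → ℝ} (hφ : DiffOK φ V) (hE : EvConst V) (hEφ : ∀ x, EvConst (φ x))
    (hH : ∀ y, H y = C y + α * ∫ ξ, V (y - rdn θ ξ) ∂ν)
    (hψ : ∀ x y, ψ x y = γ * x + α * ∫ ξ, φ x (y - rdn θ ξ) ∂ν) (x y : ℝ) (hx : 0 ≤ x) :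
    H y - H (y - x) ≤ C y - C (y - x) + (ψ x y - γ * x) := by
  have h1 := int_le2 hpos (evConst_integrable ν hθ hE y).1 (evConst_integrable ν hθ (hEφ x) y).1
    (evConst_integrable ν hθ hE (y - x)).1 (fun ξ _ => by
      have := hφ.diff x (y - rdn θ ξ) hx
      rw [show y - rdn θ ξ - x = y - x - rdn θ ξ by ring] at this
      linarith)
  rw [hH, hH, hψ]
  have := mul_le_mul_of_nonneg_left h1 hα.le
  linarith

lemma psi_ok (hpos : ν (Set.Iio 0) = 0) (hθ : 0 < θ) (hα : 0 < α) (hγ : 0 ≤ γ)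
    (hLip : ∀ x y, |C x - C y| ≤ γ * |x - y|)
    {φ ψ : ℝ → ℝ → ℝ} (hφ : DiffOK φ V) (hE : EvConst V) (hEφ : ∀ x, EvConst (φ x))
    (hH : ∀ y, H y = C y + α * ∫ ξ, V (y - rdn θ ξ) ∂ν)
    (hψ : ∀ x y, ψ x y = γ * x + α * ∫ ξ, φ x (y - rdn θ ξ) ∂ν) : DiffOK ψ H := by
  refine ⟨?_, ?_, ?_⟩
  · intro x y hx
    rw [hψ]
    have : 0 ≤ ∫ ξ, φ x (y - rdn θ ξ) ∂ν := integral_nonneg fun ξ => hφ.nonneg _ _ hx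
    positivity
  · intro x x' y y' hx hxx hyy
    rw [hψ, hψ]
    have := int_le1 hpos (evConst_integrable ν hθ (hEφ x) y).1 (evConst_integrable ν hθ (hEφ x') y').1
      (fun ξ _ => hφ.mono x x' (y - rdn θ ξ) (y' - rdn θ ξ) hx hxx (by linarith))
    have := mul_le_mul_of_nonneg_left this hα.le
    have := mul_le_mul_of_nonneg_left hxx hγ
    linarith
  · intro x y hx
    have h := psi_diff' (γ := γ) hpos hθ hα hφ hE hEφ hH hψ x y hx
    have h2 := (le_abs_self _).trans (hLip y (y - x))
    rw [show y - (y - x) = x by ring, abs_of_nonneg hx] at h2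
    linarith

lemma phi_ok {φ ψ : ℝ → ℝ → ℝ} {s S K : ℝ} (hψ : DiffOK ψ H) (hs : H s ≤ H S + K)
    (hV : ∀ y, V y = if y < s then H S + K else H y)
    (hφ : ∀ x y : ℝ, φ x y = if y < s then 0 else if y - x < s then ψ (y - s) y else ψ x y) :
    DiffOK φ V := by
  have hφ' : ∀ x y : ℝ, s ≤ y → φ x y = ψ (min x (y - s)) y := by
    intro x y hy
    rw [hφ, if_neg (by linarith)]
    split_ifs with h
    · rw [min_eq_right (by linarith)]
    · rw [min_eq_left (by linarith)]
  have hn : ∀ x y, 0 ≤ x → 0 ≤ φ x y := by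
    intro x y hx
    by_cases hy : y < s
    · rw [hφ, if_pos hy]
    · rw [hφ' x y (by linarith)]
      exact hψ.nonneg _ _ (le_min hx (by linarith))
  refine ⟨hn, ?_, ?_⟩
  · intro x x' y y' hx hxx hyy
    by_cases hy : y < s
    · rw [hφ x y, if_pos hy]; exact hn _ _ (by linarith)
    · rw [hφ' x y (by linarith), hφ' x' y' (by linarith)]
      exact hψ.mono _ _ _ _ (le_min hx (by linarith)) (min_le_min hxx (by linarith)) hyy
  · intro x y hx
    by_cases hy : y < s
    · rw [hV, hV, hφ, if_pos hy, if_pos hy, if_pos (by linarith)]; linarith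
    · rw [hφ, if_neg hy, hV y, if_neg hy, hV (y - x)]
      split_ifs with h
      · have := hψ.diff (y - s) y (by linarith)
        rw [show y - (y - s) = s by ring] at this
        linarith
      · exact hψ.diff x y hx

lemma psib_ok (hpos : ν (Set.Iio 0) = 0) (hθ : 0 < θ) (hα : 0 < α) (hγ : 0 ≤ γ)
    (hLip : ∀ x y, |C x - C y| ≤ γ * |x - y|)
    {φ ψ : ℝ → ℝ → ℝ} {φb ψb : ℝ → ℝ} (hφ : BarOK θ φb V φ) (hE : EvConst V)
    (hEφ : ∀ x, EvConst (φ x)) (hEφb : EvConst φb)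
    (hH : ∀ y, H y = C y + α * ∫ ξ, V (y - rdn θ ξ) ∂ν)
    (hψ : ∀ x y, ψ x y = γ * x + α * ∫ ξ, φ x (y - rdn θ ξ) ∂ν)
    (hψb : ∀ y, ψb y = γ * θ + α * ∫ ξ, φb (y - rdn θ ξ) ∂ν) : BarOK θ ψb H ψ := by
  refine ⟨?_, ?_, ?_, ?_⟩
  · intro y hy
    rw [hψb]
    have : 0 ≤ ∫ ξ, φb (y - rdn θ ξ) ∂ν := integral_nonneg fun ξ => hφ.nonneg _ (hy.sub_rdn ξ)
    positivity
  · intro G G' hG hG' h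
    rw [hψb, hψb]
    have := int_le1 hpos (evConst_integrable ν hθ hEφb G).1 (evConst_integrable ν hθ hEφb G').1
      (fun ξ _ => hφ.mono _ _ (hG.sub_rdn ξ) (hG'.sub_rdn ξ) (by linarith))
    have := mul_le_mul_of_nonneg_left this hα.le
    linarith
  · intro G hG
    rw [hψb, hψ]
    have := int_le1 hpos (evConst_integrable ν hθ (hEφ θ) G).1 (evConst_integrable ν hθ hEφb G).1
      (fun ξ _ => hφ.ge _ (hG.sub_rdn ξ))
    have := mul_le_mul_of_nonneg_left this hα.le
    linarith
  · intro g y G hg hG h1 h2 h3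
    have h4 := int_le2 hpos (evConst_integrable ν hθ hE g).1 (evConst_integrable ν hθ hEφb G).1
      (evConst_integrable ν hθ hE y).1 (fun ξ _ => by
      have := hφ.diff (g - rdn θ ξ) (y - rdn θ ξ) (G - rdn θ ξ) (hg.sub_rdn ξ) (hG.sub_rdn ξ)
        (by linarith) (by linarith) (by linarith)
      linarith)
    rw [hH, hH, hψb]
    have := mul_le_mul_of_nonneg_left h4 hα.le
    have h5 := (le_abs_self _).trans (hLip g y)
    rw [abs_sub_comm g y, abs_of_nonneg (by linarith : 0 ≤ y - g)] at h5
    have := mul_le_mul_of_nonneg_left (by linarith : y - g ≤ θ) hγ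
    linarith

lemma phib_ok (hθ : 0 < θ) {φ ψ φb ψb : ℝ → ℝ → ℝ} {s S K : ℝ} (hψ : DiffOK ψ H)
    (hψb : BarOK θ (ψb θ) H ψ) (hs : OnGrid θ s)
    (hV : ∀ y, V y = if y < s then H S + K else H y)
    (hφ : ∀ x y : ℝ, φ x y = if y < s then 0 else if y - x < s then ψ (y - s) y else ψ x y)
    (hφb : ∀ x y : ℝ, φb x y = if y < s then 0 else if y - x < s then ψb (y - s + θ) y else ψb x y) :
    BarOK θ (φb θ) V φ := by
  have e : ∀ G, OnGrid θ G → φb θ G = if G < s then 0 else ψb θ G := by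
    intro G hG
    rw [hφb]
    split_ifs with h1 h2
    · rfl
    · rcases eq_or_lt_of_le (not_lt.1 h1) with h | h
      · rw [← h]; simp
      · have := hs.add_le hθ hG h; linarith
    · rfl
  have hn : ∀ G, OnGrid θ G → 0 ≤ φb θ G := by
    intro G hG
    rw [e G hG]; split_ifs
    · exact le_rfl
    · exact hψb.nonneg G hG
  refine ⟨hn, ?_, ?_, ?_⟩
  · intro G G' hG hG' h
    by_cases h1 : G < s
    · rw [e G hG, if_pos h1]; exact hn _ hG'
    · rw [e G hG, if_neg h1, e G' hG', if_neg (by linarith)]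
      exact hψb.mono _ _ hG hG' h
  · intro G hG
    rw [e G hG, hφ]
    split_ifs with h1 h2
    · exact le_rfl
    · exact (hψ.mono _ _ _ _ (by linarith) (by linarith) le_rfl).trans (hψb.ge G hG)
    · exact hψb.ge G hG
  · intro g y G hg hG h1 h2 h3
    by_cases h4 : y < s
    · rw [hV g, hV y, if_pos h4, if_pos (by linarith)]
      have := hn G hG
      linarith
    · have h5 : ¬ g < s := fun h => by have := hg.add_le hθ hs h; linarith
      rw [hV g, hV y, if_neg h4, if_neg h5, e G hG, if_neg (by linarith)]
      exact hψb.diff g y G hg hG h1 h2 h3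

end

lemma phi_base {C V : ℝ → ℝ} {γ s S K : ℝ} (hγ : 0 ≤ γ)
    (hLip : ∀ x y, |C x - C y| ≤ γ * |x - y|) (hs : C s = C S + K)
    (hV : ∀ y, V y = if y < s then C S + K else C y) {φ : ℝ → ℝ → ℝ}
    (hφ : ∀ x y : ℝ, φ x y = if y < s then 0 else γ * x) : DiffOK φ V := by
  have hn : ∀ x y, 0 ≤ x → 0 ≤ φ x y := by
    intro x y hx
    rw [hφ]; split_ifs
    · exact le_rfl
    · positivity
  have hL : ∀ a b, b ≤ a → C a - C b ≤ γ * (a - b) := by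
    intro a b h
    have := (le_abs_self _).trans (hLip a b)
    rwa [abs_of_nonneg (by linarith : 0 ≤ a - b)] at this
  refine ⟨hn, ?_, ?_⟩
  · intro x x' y y' hx hxx hyy
    by_cases hy : y < s
    · rw [hφ x y, if_pos hy]; exact hn _ _ (by linarith)
    · rw [hφ, hφ, if_neg hy, if_neg (by linarith)]
      exact mul_le_mul_of_nonneg_left hxx hγ
  · intro x y hx
    by_cases hy : y < s
    · rw [hV, hV, hφ, if_pos hy, if_pos hy, if_pos (by linarith)]; linarith
    · rw [hφ, if_neg hy, hV y, if_neg hy, hV (y - x)]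
      split_ifs with h
      · have := hL y s (by linarith)
        have := mul_le_mul_of_nonneg_left (by linarith : y - s ≤ x) hγ
        linarith
      · have := hL y (y - x) (by linarith)
        rwa [show y - (y - x) = x by ring] at this

lemma phib_base {C V : ℝ → ℝ} {θ γ s S K : ℝ} (hθ : 0 < θ) (hγ : 0 ≤ γ)
    (hLip : ∀ x y, |C x - C y| ≤ γ * |x - y|) (hs : C s = C S + K)
    (hV : ∀ y, V y = if y < s then C S + K else C y) {φ φb : ℝ → ℝ → ℝ}
    (hφ : ∀ x y : ℝ, φ x y = if y < s then 0 else γ * x)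
    (hφb : ∀ x y : ℝ, φb x y = if y < s then 0 else γ * x) : BarOK θ (φb θ) V φ := by
  have e : ∀ y, φb θ y = φ θ y := fun y => by rw [hφ, hφb]
  have h := phi_base hγ hLip hs hV hφ
  refine ⟨fun G _ => ?_, fun G G' _ _ hG => ?_, fun G _ => (e G).ge, ?_⟩
  · rw [e]; exact h.nonneg _ _ hθ.le
  · rw [e, e]; exact h.mono _ _ _ _ hθ.le le_rfl hG
  · intro g y G _ _ h1 h2 h3
    have hL : ∀ a b, a ≤ b → C a - C b ≤ γ * (b - a) := by
      intro a b h
      have := (le_abs_self _).trans (hLip a b)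
      rwa [abs_sub_comm, abs_of_nonneg (by linarith : 0 ≤ b - a)] at this
    have hn := h.nonneg θ G hθ.le
    rw [e]
    by_cases hy : y < s
    · rw [hV, hV, if_pos hy, if_pos (by linarith)]; linarith
    · rw [hφ, if_neg (by linarith), hV y, if_neg hy, hV g]
      have := mul_le_mul_of_nonneg_left (by linarith : y - g ≤ θ) hγ
      split_ifs with h4
      · have := hL s y (by linarith)
        have := mul_le_mul_of_nonneg_left (by linarith : y - s ≤ y - g) hγ
        linarith
      · have := hL g y (by linarith)
        linarith

lemma good_base {C : ℝ → ℝ} {s S K : ℝ} (hC : ConvexOn ℝ Set.univ C) (hK : 0 ≤ K)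
    (hS : ∀ y, C S ≤ C y) (hsS : s ≤ S) (hs : C s = C S + K) :
    Good (fun _ => True) K C s S := by
  refine ⟨hK, ?_, fun z _ => hS z, hs.le, fun z _ hz => ?_, trivial⟩
  · intro x w y _ _ _ h1 h2
    have := convex_three hC h1 h2
    nlinarith [mul_nonneg (sub_pos.2 h1).le hK]
  · have := convex_anti hC hS hz.le hsS
    linarith

lemma good_step {ν : Measure ℝ} [IsProbabilityMeasure ν] (hpos : ν (Set.Iio 0) = 0)
    {θ : ℝ} (hθ : 0 < θ) {α K K' : ℝ} (hα : 0 < α) (hK : 0 ≤ K) (hKK : α * K' ≤ K)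
    {C v H : ℝ → ℝ} (hC : ConvexOn ℝ Set.univ C) {Cm z0 SU I Ib Ib' s' A S s : ℝ}
    (hCm : ∀ y, C Cm ≤ C y)
    (hz0 : OnGrid θ z0) (hz0' : z0 < Cm) (hz0'' : Cm ≤ z0 + θ) (hCmSU : Cm ≤ SU)
    (hCSU : C z0 + K < C SU)
    (hv : KConv (OnGrid θ) K' v)
    (hvle : ∀ x y, OnGrid θ x → OnGrid θ y → x ≤ y → v x ≤ v y + K')
    (hvA : ∀ y < s', v y = A) (hIs : Ib' ≤ s')
    (hH : ∀ y, H y = C y + α * ∫ ξ, v (y - rdn θ ξ) ∂ν)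
    (hI : IsGreatest {w | (∃ m : ℤ, w = (m : ℝ) * θ) ∧ w < min (Ib' - θ) Cm} I)
    (hIb : IsGreatest {w | (∃ m : ℤ, w = (m : ℝ) * θ) ∧ w ≤ I ∧ C I + K < C w} (Ib - θ))
    (hS : IsGreatest {w | (∃ m : ℤ, w = (m : ℝ) * θ) ∧ I ≤ w ∧ w ≤ SU ∧
        ∀ u, (∃ n : ℤ, u = (n : ℝ) * θ) → I ≤ u → u ≤ SU → H w ≤ H u} S)
    (hs0 : K = 0 → s = S)
    (hs1 : 0 < K →
      IsLeast {w | (∃ m : ℤ, w = (m : ℝ) * θ) ∧ Ib ≤ w ∧ w ≤ S ∧ H w ≤ H S + K} s) :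
    Good (OnGrid θ) K H s S ∧ Ib ≤ s ∧ s ≤ SU := by
  have hE : EvConst v := ⟨s', A, hvA⟩
  obtain ⟨⟨hIg, hIlt⟩, hImax⟩ := hI
  obtain ⟨⟨hIbg, hIbI, hIbC⟩, hIbmax⟩ := hIb
  obtain ⟨⟨hSg, hIS, hSSU, hSmin⟩, -⟩ := hS
  have hI1 : I < Ib' - θ := lt_of_lt_of_le hIlt (min_le_left _ _)
  have hI2 : I < Cm := lt_of_lt_of_le hIlt (min_le_right _ _)
  have hIbI' : Ib ≤ I := by
    have hne : Ib - θ ≠ I := by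
      intro h; rw [h] at hIbC; linarith
    have := OnGrid.add_le hθ hIbg hIg (lt_of_le_of_ne hIbI hne)
    linarith
  have hHlow : ∀ z ≤ I, H z = C z + α * A := by
    intro z hz
    have : ∀ ξ, v (z - rdn θ ξ) = A := fun ξ => hvA _ (by
      have := neg_le_rdn (ξ := ξ) hθ; linarith)
    rw [hH]; simp [this]
  have hanti : ∀ z z', z ≤ z' → z' ≤ I → H z' ≤ H z := by
    intro z z' h1 h2
    rw [hHlow z (by linarith), hHlow z' h2]
    have := convex_anti hC hCm h1 (by linarith)
    linarith
  have hIz0 : I ≤ z0 := by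
    by_contra hc
    have := OnGrid.add_le hθ hz0 hIg (not_le.1 hc)
    linarith
  have hmin : ∀ z, OnGrid θ z → H S ≤ H z := by
    intro z hz
    have hSI : H S ≤ H I := hSmin I hIg le_rfl (by linarith)
    rcases lt_or_ge z I with h | h
    · exact hSI.trans (hanti _ _ h.le le_rfl)
    · rcases le_or_gt z SU with h' | h'
      · exact hSmin z hz h h'
      · refine (hSmin z0 hz0 hIz0 (by linarith)).trans ?_
        have h1 := int_le2 (c := fun _ => K') hpos (evConst_integrable ν hθ hE z0).1
          (evConst_integrable ν hθ hE z).1 (integrable_const K') (fun ξ _ => by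
            exact hvle (z0 - rdn θ ξ) (z - rdn θ ξ) (hz0.sub_rdn ξ) (hz.sub_rdn ξ) (by linarith))
        simp only [integral_const, probReal_univ, smul_eq_mul, one_mul] at h1
        have h2 := mul_le_mul_of_nonneg_left h1 hα.le
        have h3 := convex_mono hC hCm h'.le hCmSU
        rw [hH, hH]
        linarith
  have hconv : KConv (OnGrid θ) K H :=
    KConv.step hθ (fun x ξ hx => hx.sub_rdn ξ) hα hKK hC hv hE ν hH
  rcases eq_or_lt_of_le hK with h0 | h0
  · have hsS := hs0 h0.symm
    subst hsS
    refine ⟨⟨hK, hconv, hmin, by linarith, fun z hz _ => ?_, hSg⟩, by linarith, hSSU⟩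
    have := hmin z hz
    linarith
  · obtain ⟨⟨hsg, hsIb, hsS, hsH⟩, hsmin⟩ := hs1 h0
    refine ⟨⟨hK, hconv, hmin, hsH, fun z hz hzs => ?_, hsg⟩, hsIb, by linarith⟩
    by_cases h : z < Ib
    · have hz' : z ≤ Ib - θ := by
        by_contra hc
        have := OnGrid.add_le hθ hIbg hz (not_le.1 hc)
        linarith
      have h1 := hanti z (Ib - θ) hz' hIbI
      have h2 := hHlow (Ib - θ) hIbI
      have h3 := hHlow I le_rfl
      have h4 := hmin I hIg
      linarith
    · by_contra hc
      have := hsmin ⟨hz, not_lt.1 h, by linarith, by linarith⟩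
      linarith

lemma om_mono {ν : Measure ℝ} [IsProbabilityMeasure ν] (hpos : ν (Set.Iio 0) = 0)
    {θ : ℝ} (hθ : 0 < θ) {α γ : ℝ} (hα : 0 < α) {H ob om : ℝ → ℝ} {ψ : ℝ → ℝ → ℝ}
    (hψ : DiffOK ψ H) (hob : Monotone ob) (hE : EvConst ob)
    (hom : ∀ x, om x = ψ θ x - γ * θ + α * ∫ ξ, ob (x - rdn θ ξ) ∂ν) : Monotone om := by
  intro x y h
  rw [hom, hom]
  have h1 := int_le1 hpos (evConst_integrable ν hθ hE x).1 (evConst_integrable ν hθ hE y).1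
    (fun ξ _ => hob (by linarith))
  have := mul_le_mul_of_nonneg_left h1 hα.le
  have := hψ.mono θ θ x y hθ.le le_rfl h
  linarith

lemma omb_mono {om omb : ℝ → ℝ} {SU eta : ℝ} (hom : Monotone om)
    (homb : ∀ x, omb x = if x ≤ SU then eta else max eta (om x)) : Monotone omb := by
  intro x y h
  rw [homb, homb]
  split_ifs with h1 h2 h2
  · exact le_rfl
  · exact le_max_left _ _
  · exact absurd (h.trans h2) h1
  · exact max_le_max le_rfl (hom h)

lemma final_step {ν : Measure ℝ} [IsProbabilityMeasure ν] (hpos : ν (Set.Iio 0) = 0)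
    {θ : ℝ} (hθ : 0 < θ) {α γ K K' : ℝ} (hα : 0 < α) (hγ : 0 ≤ γ) (hK : 0 ≤ K) (hKK : α * K' ≤ K)
    {C v vs ob H Hs V om omb : ℝ → ℝ} {φ ψ : ℝ → ℝ → ℝ} {φb ψb : ℝ → ℝ}
    (hC : ConvexOn ℝ Set.univ C) (hLip : ∀ x y, |C x - C y| ≤ γ * |x - y|)
    {Cm z0 SU S s eta : ℝ} (hCm : ∀ y, C Cm ≤ C y)
    (hz0' : z0 < Cm) (hCmSU : Cm ≤ SU) (hSUg : OnGrid θ SU)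
    (hCSU : C z0 + K < C SU)
    (hE : EvConst v) (hvs : VOK vs) (hvsle : ∀ x y, x < y → vs x ≤ K' + vs y)
    (hob : Monotone ob) (hEob : EvConst ob) (hind : ∀ x, v x - vs x ≤ ob x)
    (hφ : DiffOK φ v) (hEφ : ∀ x, EvConst (φ x)) (hφb : BarOK θ φb v φ) (hEφb : EvConst φb)
    (hH : ∀ y, H y = C y + α * ∫ ξ, v (y - rdn θ ξ) ∂ν)
    (hHs : ∀ y, Hs y = C y + α * ∫ ξ, vs (y - ξ) ∂ν)
    (hψ : ∀ x y, ψ x y = γ * x + α * ∫ ξ, φ x (y - rdn θ ξ) ∂ν)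
    (hψb : ∀ y, ψb y = γ * θ + α * ∫ ξ, φb (y - rdn θ ξ) ∂ν)
    (hom : ∀ x, om x = ψ θ x - γ * θ + α * ∫ ξ, ob (x - rdn θ ξ) ∂ν)
    (heta : eta = ψb SU + om SU)
    (homb : ∀ x, omb x = if x ≤ SU then eta else max eta (om x))
    (hV : ∀ y, V y = if y < s then H S + K else H y)
    (hg : Good (OnGrid θ) K H s S) (hsSU : s ≤ SU) :
    (∀ x, H x - Hs x ≤ om x) ∧
    ∀ x y, x ≤ y → V x - omb x ≤ K * (if x < y then (1 : ℝ) else 0) + Hs y := by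
  have hψok := psi_ok hpos hθ hα hγ hLip hφ hE hEφ hH hψ
  have hψbok := psib_ok hpos hθ hα hγ hLip hφb hE hEφ hEφb hH hψ hψb
  have hommono := om_mono hpos hθ hα hψok hob hEob hom
  have iv := fun y => (evConst_integrable ν hθ hE y).1
  have iob := fun y => (evConst_integrable ν hθ hEob y).1
  have iφ := fun x y => (evConst_integrable ν hθ (hEφ x) y).1
  have iφb := fun y => (evConst_integrable ν hθ hEφb y).1
  have ivs := hvs.integrable ν hpos
  -- first claim
  have hfirst : ∀ x, H x - Hs x ≤ om x := by
    intro x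
    have h1 := int_le3 hpos (iv x) (ivs x) (iφ θ x) (iob x) (fun ξ hξ => by
      have a1 := rdn_lt hθ hξ
      have a2 := le_rdn (ξ := ξ) hθ
      have b1 := hφ.diff (ξ - rdn θ ξ) (x - rdn θ ξ) (by linarith)
      rw [show x - rdn θ ξ - (ξ - rdn θ ξ) = x - ξ by ring] at b1
      have b2 := hφ.mono (ξ - rdn θ ξ) θ (x - rdn θ ξ) (x - rdn θ ξ) (by linarith) (by linarith) le_rfl
      have b3 := hind (x - ξ)
      have b4 := hob (by linarith : x - ξ ≤ x - rdn θ ξ)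
      linarith)
    have h2 := mul_le_mul_of_nonneg_left h1 hα.le
    rw [hH, hHs, hom, hψ]
    linarith
  have hψb0 := hψbok.nonneg SU hSUg
  have homb_le : ∀ x, om x ≤ omb x := by
    intro x
    rw [homb]
    split_ifs with h
    · have := hommono h
      linarith
    · exact le_max_right _ _
  have heta_le : ∀ x, eta ≤ omb x := by
    intro x
    rw [homb]
    split_ifs with h
    · exact le_rfl
    · exact le_max_left _ _
  -- F0
  have hF0 : ∀ x y, x < y → Hs x ≤ C x - C y + K + Hs y := by
    intro x y h
    have h1 := int_le2 (b := fun _ => K') hpos (ivs x) (integrable_const K') (ivs y)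
      (fun ξ _ => hvsle (x - ξ) (y - ξ) (by linarith))
    simp only [integral_const, probReal_univ, smul_eq_mul, one_mul] at h1
    have h2 := mul_le_mul_of_nonneg_left h1 hα.le
    rw [hHs, hHs]
    linarith
  have hF1 : ∀ y, SU < y → Hs z0 ≤ Hs y ∧ C z0 + K < C y := by
    intro y hy
    have h1 := convex_mono hC hCm hy.le hCmSU
    have h2 := hF0 z0 y (by linarith)
    exact ⟨by linarith, by linarith⟩
  -- H at the floor of w versus Hs at w
  have hfl : ∀ w g, OnGrid θ g → g ≤ w → w < g + θ → w ≤ SU → H g ≤ Hs w + eta := by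
    intro w g hgg h1 h2 h3
    have a1 := hψbok.diff g w SU hgg hSUg h1 h2 h3
    have a2 := hfirst w
    have a3 := hommono h3
    linarith
  have hF2 : ∀ w, H S ≤ Hs w + eta := by
    have key : ∀ w, w ≤ SU → H S ≤ Hs w + eta := by
      intro w hw
      obtain ⟨g, hgg, h1, h2⟩ := exists_grid_floor hθ w
      exact (hg.min g hgg).trans (hfl w g hgg h1 h2 hw)
    intro w
    rcases le_or_gt w SU with h | h
    · exact key w h
    · have := key z0 (by linarith)
      have := (hF1 w h).1
      linarith
  have hF3 : ∀ w, w < s → H S + K ≤ Hs w + eta := by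
    intro w hw
    obtain ⟨g, hgg, h1, h2⟩ := exists_grid_floor hθ w
    exact (hg.below g hgg (by linarith)).trans (hfl w g hgg h1 h2 (by linarith))
  -- F5
  have hF5 : ∀ x y, s ≤ x → x < Cm → x < y → y ≤ SU → H x ≤ K + Hs y + eta := by
    intro x y hsx hxC hxy hySU
    obtain ⟨g, hgg, h1, h2⟩ := exists_grid_floor hθ x
    obtain ⟨g', hgg', h1', h2'⟩ := exists_grid_floor hθ y
    have c1 : H x - H g ≤ ψ θ SU - γ * θ := by
      have a1 := psi_diff' (γ := γ) hpos hθ hα hφ hE hEφ hH hψ (x - g) x (by linarith)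
      rw [show x - (x - g) = g by ring] at a1
      have a2 := convex_anti hC hCm h1 hxC.le
      have a3 : ψ (x - g) x - γ * (x - g) ≤ ψ θ SU - γ * θ := by
        rw [hψ, hψ]
        have b1 := int_le1 hpos (iφ (x - g) x) (iφ θ SU) (fun ξ _ =>
          hφ.mono (x - g) θ (x - rdn θ ξ) (SU - rdn θ ξ) (by linarith) (by linarith) (by linarith))
        have := mul_le_mul_of_nonneg_left b1 hα.le
        linarith
      linarith
    have hsg : s ≤ g := by
      by_contra hc
      have := OnGrid.add_le hθ hgg hg.Ps (not_le.1 hc)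
      linarith
    have hg' : g ≤ g' := by
      by_contra hc
      have := OnGrid.add_le hθ hgg' hgg (not_le.1 hc)
      linarith
    have c2 := hg.c hgg hgg' hsg hg'
    have c3 : H g' ≤ Hs y + ψb SU + α * ∫ ξ, ob (SU - rdn θ ξ) ∂ν := by
      have b1 := int_le3 hpos (iv g') (ivs y) (iφb SU) (iob SU) (fun ξ hξ => by
        have a1 := rdn_lt hθ hξ
        have a2 := le_rdn (ξ := ξ) hθ
        have b3 := hind (y - ξ)
        have b4 := hob (by linarith : y - ξ ≤ SU - rdn θ ξ)
        have b5 : v (g' - rdn θ ξ) - v (y - ξ) ≤ φb (SU - rdn θ ξ) := by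
          rcases le_or_gt (y - ξ) (g' - rdn θ ξ) with h | h
          · have d1 := hφ.diff (g' - rdn θ ξ - (y - ξ)) (g' - rdn θ ξ) (by linarith)
            rw [show g' - rdn θ ξ - (g' - rdn θ ξ - (y - ξ)) = y - ξ by ring] at d1
            have d2 := hφ.mono (g' - rdn θ ξ - (y - ξ)) θ (g' - rdn θ ξ) (g' - rdn θ ξ)
              (by linarith) (by linarith) le_rfl
            have d3 := hφb.ge _ (hgg'.sub_rdn ξ)
            have d4 := hφb.mono _ _ (hgg'.sub_rdn ξ) (hSUg.sub_rdn ξ) (by linarith)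
            linarith
          · exact hφb.diff _ _ _ (hgg'.sub_rdn ξ) (hSUg.sub_rdn ξ) h.le (by linarith) (by linarith)
        linarith)
      have b2 := mul_le_mul_of_nonneg_left b1 hα.le
      have h5 := (le_abs_self _).trans (hLip g' y)
      rw [abs_sub_comm g' y, abs_of_nonneg (by linarith : 0 ≤ y - g')] at h5
      have := mul_le_mul_of_nonneg_left (by linarith : y - g' ≤ θ) hγ
      rw [hH, hHs, hψb]
      linarith
    rw [heta, hom]
    linarith
  refine ⟨hfirst, ?_⟩
  intro x y hxy
  have e1 := heta_le x
  rcases lt_or_ge x s with hx | hx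
  · rw [hV, if_pos hx]
    rcases eq_or_lt_of_le hxy with h | h
    · subst h
      have := hF3 x hx
      simp only [lt_irrefl, if_false]
      linarith
    · have := hF2 y
      simp only [h, if_true]
      linarith
  · rw [hV, if_neg (by linarith)]
    have f1 := hfirst x
    have f2 := homb_le x
    rcases eq_or_lt_of_le hxy with h | h
    · subst h
      simp only [lt_irrefl, if_false]
      linarith
    · simp only [h, if_true]
      by_cases hCC : C x ≤ C y
      · have := hF0 x y h
        linarith
      · have hxC : x < Cm := by
          by_contra hc
          exact hCC (convex_mono hC hCm hxy (not_lt.1 hc))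
        rcases le_or_gt y SU with hy | hy
        · have := hF5 x y hx hxC h hy
          linarith
        · obtain ⟨k1, k2⟩ := hF1 y hy
          have hxz : x < z0 := by
            by_contra hc
            have := convex_anti hC hCm (not_lt.1 hc) hxC.le
            linarith
          have := hF5 x z0 hx hxC hxz (by linarith)
          linarith

theorem stmt14
    (T : ℕ) (hT : 2 ≤ T)
    (α : ℝ) (hα0 : 0 < α) (hα1 : α ≤ 1)
    (K : ℕ → ℝ) (hK0 : ∀ t, t < T → 0 ≤ K t)
    (hKmono : ∀ t, t + 2 ≤ T → α * K (t + 1) ≤ K t)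
    (ν : ℕ → MeasureTheory.Measure ℝ)
    (hprob : ∀ t, MeasureTheory.IsProbabilityMeasure (ν t))
    (hpos : ∀ t, ν t (Set.Iio 0) = 0)
    (F : ℕ → ℝ → ℝ) (hF : ∀ t x, F t x = (ν t (Set.Iic x)).toReal)
    (C : ℕ → ℝ → ℝ)
    (hCconv : ∀ t, t < T → ConvexOn ℝ Set.univ (C t))
    (hCcoer : ∀ t, t < T → Filter.Tendsto (C t) (Filter.cocompact ℝ) Filter.atTop)
    (Hstar Vstar : ℕ → ℝ → ℝ)
    (hVstarT : ∀ x, Vstar T x = 0)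
    (hHstar : ∀ t, t < T → ∀ y,
      Hstar t y = C t y + α * ∫ ξ, Vstar (t + 1) (y - ξ) ∂(ν t))
    (hVstar : ∀ t, t < T → ∀ x,
      Vstar t x = sInf ((fun y => K t * (if x < y then (1 : ℝ) else 0) + Hstar t y) '' Set.Ici x))
    (θ : ℝ) (hθ : 0 < θ)
    (f : ℕ → ℤ → ℝ)
    (hf : ∀ t (n : ℤ), f t n = F t (((n : ℝ) + 1) * θ) - F t ((n : ℝ) * θ))
    (Cm SU : ℕ → ℝ)
    (hCm : ∀ t, t < T → IsLeast {x | ∀ y, C t x ≤ C t y} (Cm t))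
    (hSU : ∀ t, t < T → ∀ n0 : ℤ, (n0 : ℝ) * θ < Cm t → Cm t ≤ ((n0 : ℝ) + 1) * θ →
      IsLeast {w | (∃ m : ℤ, w = (m : ℝ) * θ) ∧ Cm t ≤ w ∧ C t ((n0 : ℝ) * θ) + K t < C t w} (SU t))
    (s S : ℕ → ℝ) (I Ibar : ℕ → ℝ)
    (hsT1a : s (T - 1) ≤ Cm (T - 1))
    (hsT1b : C (T - 1) (s (T - 1)) = C (T - 1) (Cm (T - 1)) + K (T - 1))
    (hIbarT1 : Ibar (T - 1) = s (T - 1))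
    (hI : ∀ t, t + 2 ≤ T →
      IsGreatest {w | (∃ m : ℤ, w = (m : ℝ) * θ) ∧ w < min (Ibar (t + 1) - θ) (Cm t)} (I t))
    (hIbar : ∀ t, t + 2 ≤ T →
      IsGreatest {w | (∃ m : ℤ, w = (m : ℝ) * θ) ∧ w ≤ I t ∧ C t (I t) + K t < C t w} (Ibar t - θ))
    (H V : ℕ → ℝ → ℝ)
    (hHT1 : ∀ y, H (T - 1) y = C (T - 1) y)
    (hST1 : S (T - 1) = Cm (T - 1))
    (hV : ∀ t, t < T → ∀ y, V t y = if y < s t then H t (S t) + K t else H t y)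
    (hHrec : ∀ t, t + 2 ≤ T → ∀ y,
      H t y = C t y + α * ∑' n : ℕ, V (t + 1) (y - ((n : ℝ) - 1) * θ) * f t ((n : ℤ) - 1))
    (hSdef : ∀ t, t + 2 ≤ T →
      IsGreatest {w | (∃ m : ℤ, w = (m : ℝ) * θ) ∧ I t ≤ w ∧ w ≤ SU t ∧
        ∀ u, (∃ n : ℤ, u = (n : ℝ) * θ) → I t ≤ u → u ≤ SU t → H t w ≤ H t u} (S t))
    (hsdef0 : ∀ t, t + 2 ≤ T → K t = 0 → s t = S t)
    (hsdef1 : ∀ t, t + 2 ≤ T → 0 < K t →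
      IsLeast {w | (∃ m : ℤ, w = (m : ℝ) * θ) ∧ Ibar t ≤ w ∧ w ≤ S t ∧ H t w ≤ H t (S t) + K t} (s t))
    (γ : ℕ → ℝ) (hγ : ∀ t, t < T → 0 ≤ γ t)
    (hLip : ∀ t, t < T → ∀ x y, |C t x - C t y| ≤ γ t * |x - y|)
    (psi phi : ℕ → ℝ → ℝ → ℝ)
    (hpsiT1 : ∀ x y : ℝ, psi (T - 1) x y = γ (T - 1) * x)
    (hphiT1 : ∀ x y : ℝ, phi (T - 1) x y = if y < s (T - 1) then 0 else γ (T - 1) * x)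
    (hpsiA : ∀ t, t + 2 ≤ T → ∀ x y : ℝ, y < s (t + 1) - θ → psi t x y = γ t * x)
    (hpsiB : ∀ t, t + 2 ≤ T → ∀ x y : ℝ, s (t + 1) - θ ≤ y → ∀ n : ℤ,
      ((n : ℝ) - 1) * θ ≤ y - s (t + 1) → y - s (t + 1) < (n : ℝ) * θ →
      psi t x y = γ t * x
        + α * ∑ j ∈ Finset.Icc (-1 : ℤ) (n - 1), phi (t + 1) x (y - (j : ℝ) * θ) * f t j)
    (hphi : ∀ t, t + 2 ≤ T → ∀ x y : ℝ, phi t x y =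
      if y < s t then 0 else if y - x < s t then psi t (y - s t) y else psi t x y)
    (psib phib : ℕ → ℝ → ℝ → ℝ)
    (hpsibT1 : ∀ x y : ℝ, psib (T - 1) x y = γ (T - 1) * x)
    (hphibT1 : ∀ x y : ℝ, phib (T - 1) x y = if y < s (T - 1) then 0 else γ (T - 1) * x)
    (hpsibA : ∀ t, t + 2 ≤ T → ∀ x y : ℝ, y < s (t + 1) - θ → psib t x y = γ t * x)
    (hpsibB : ∀ t, t + 2 ≤ T → ∀ x y : ℝ, s (t + 1) - θ ≤ y → ∀ n : ℤ,
      ((n : ℝ) - 1) * θ ≤ y - s (t + 1) → y - s (t + 1) < (n : ℝ) * θ →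
      psib t x y = γ t * x
        + α * ∑ j ∈ Finset.Icc (-1 : ℤ) (n - 1), phib (t + 1) x (y - (j : ℝ) * θ) * f t j)
    (hphib : ∀ t, t + 2 ≤ T → ∀ x y : ℝ, phib t x y =
      if y < s t then 0 else if y - x < s t then psib t (y - s t + θ) y else psib t x y)
    (om omb : ℕ → ℝ → ℝ) (eta : ℕ → ℝ)
    (homT1 : ∀ x, om (T - 1) x = 0) (hombT1 : ∀ x, omb (T - 1) x = 0) (hetaT1 : eta (T - 1) = 0)
    (hom : ∀ t, t + 2 ≤ T → ∀ x, om t x =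
      psi t θ x - γ t * θ + α * ∑' n : ℕ, omb (t + 1) (x - ((n : ℝ) - 1) * θ) * f t ((n : ℤ) - 1))
    (heta : ∀ t, t + 2 ≤ T → eta t = psib t θ (SU t) + om t (SU t))
    (homb : ∀ t, t + 2 ≤ T → ∀ x, omb t x = if x ≤ SU t then eta t else max (eta t) (om t x))
    :
    ∀ t, t < T → ∀ x : ℝ,
      H t x - Hstar t x ≤ om t x ∧ V t x - Vstar t x ≤ omb t x := by
  have hprob' := hprob
  have hVE : ∀ t, t < T → EvConst (V t) := fun t ht =>
    ⟨s t, H t (S t) + K t, fun x hx => by rw [hV t ht, if_pos hx]⟩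
  have hphi0 : ∀ t, t < T → ∀ x y, y < s t → phi t x y = 0 := by
    intro t ht x y hy
    rcases (by omega : t + 2 ≤ T ∨ t = T - 1) with h | h
    · rw [hphi t h, if_pos hy]
    · subst h; rw [hphiT1, if_pos hy]
  have hphib0 : ∀ t, t < T → ∀ x y, y < s t → phib t x y = 0 := by
    intro t ht x y hy
    rcases (by omega : t + 2 ≤ T ∨ t = T - 1) with h | h
    · rw [hphib t h, if_pos hy]
    · subst h; rw [hphibT1, if_pos hy]
  have hphiE : ∀ t, t < T → ∀ x, EvConst (phi t x) := fun t ht x => ⟨s t, 0, hphi0 t ht x⟩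
  have hphibE : ∀ t, t < T → ∀ x, EvConst (phib t x) := fun t ht x => ⟨s t, 0, hphib0 t ht x⟩
  have hombE : ∀ t, t < T → EvConst (omb t) := by
    intro t ht
    rcases (by omega : t + 2 ≤ T ∨ t = T - 1) with h | h
    · exact ⟨SU t, eta t, fun x hx => by rw [homb t h, if_pos hx.le]⟩
    · subst h; exact ⟨0, 0, fun x _ => hombT1 x⟩
  have hHint : ∀ t, t + 2 ≤ T → ∀ y, H t y = C t y + α * ∫ ξ, V (t + 1) (y - rdn θ ξ) ∂(ν t) := by
    intro t ht y
    rw [hHrec t ht, integral_rdn (ν t) (hpos t) hθ (F t) (hF t) (f t) (hf t) (hVE (t + 1) (by omega)) y]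
  have homint : ∀ t, t + 2 ≤ T → ∀ x, om t x =
      psi t θ x - γ t * θ + α * ∫ ξ, omb (t + 1) (x - rdn θ ξ) ∂(ν t) := by
    intro t ht y
    rw [hom t ht, integral_rdn (ν t) (hpos t) hθ (F t) (hF t) (f t) (hf t)
      (hombE (t + 1) (by omega)) y]
  have hpsi : ∀ t, t + 2 ≤ T → ∀ x y, psi t x y =
      γ t * x + α * ∫ ξ, phi (t + 1) x (y - rdn θ ξ) ∂(ν t) := by
    intro t ht x y
    exact psi_eq (ν t) (hpos t) hθ (F t) (hF t) (f t) (hf t) (phi (t + 1) x) (s (t + 1)) _ α y _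
      (hphi0 (t + 1) (by omega) x) (hpsiA t ht x y) (hpsiB t ht x y)
  have hpsib : ∀ t, t + 2 ≤ T → ∀ x y, psib t x y =
      γ t * x + α * ∫ ξ, phib (t + 1) x (y - rdn θ ξ) ∂(ν t) := by
    intro t ht x y
    exact psi_eq (ν t) (hpos t) hθ (F t) (hF t) (f t) (hf t) (phib (t + 1) x) (s (t + 1)) _ α y _
      (hphib0 (t + 1) (by omega) x) (hpsibA t ht x y) (hpsibB t ht x y)
  have hCmin : ∀ t, t < T → ∀ y, C t (Cm t) ≤ C t y := fun t ht => (hCm t ht).1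
  have hCmeas : ∀ t, t < T → Measurable (C t) := by
    intro t ht
    have : LipschitzWith (γ t).toNNReal (C t) := by
      apply LipschitzWith.of_dist_le_mul
      intro x y
      rw [Real.dist_eq, Real.dist_eq, Real.coe_toNNReal _ (hγ t ht)]
      exact hLip t ht x y
    exact this.continuous.measurable
  have hVS : ∀ t, t < T → VOK (Vstar t) ∧ ∀ x y, x < y → Vstar t x ≤ K t + Vstar t y := by
    have step : ∀ t, t < T → VOK (Vstar (t + 1)) →
        VOK (Vstar t) ∧ ∀ x y, x < y → Vstar t x ≤ K t + Vstar t y := fun t ht hv =>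
      hv.step (ν t) (hpos t) hα0 (hK0 t ht) (hCmeas t ht) ⟨_, hCmin t ht⟩ (hHstar t ht) (hVstar t ht)
    refine down_ind hT _ (step (T - 1) (by omega) ?_) (fun t ht h => step t (by omega) h.1)
    have e : Vstar (T - 1 + 1) = fun _ => 0 := by
      rw [show T - 1 + 1 = T by omega]; exact funext hVstarT
    rw [e]
    exact ⟨measurable_const, ⟨0, fun _ => le_rfl⟩, fun _ => ⟨0, fun _ _ => le_rfl⟩⟩
  have hleV : ∀ t, t < T → (∀ x y, x ≤ y →
      V t x - omb t x ≤ K t * (if x < y then (1 : ℝ) else 0) + Hstar t y) →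
      ∀ x, V t x - Vstar t x ≤ omb t x := by
    intro t ht h x
    have : V t x - omb t x ≤ Vstar t x := by
      rw [hVstar t ht]
      refine le_csInf ⟨_, x, Set.self_mem_Ici, rfl⟩ ?_
      rintro _ ⟨y, hy, rfl⟩
      exact h x y hy
    linarith
  have main : ∀ t, t < T → (KConv (OnGrid θ) (K t) (V t) ∧
      (∀ x y, OnGrid θ x → OnGrid θ y → x ≤ y → V t x ≤ V t y + K t) ∧ Ibar t ≤ s t ∧
      DiffOK (phi t) (V t) ∧ BarOK θ (phib t θ) (V t) (phi t) ∧ Monotone (omb t)) ∧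
      (∀ x, V t x - Vstar t x ≤ omb t x) ∧ (∀ x, H t x - Hstar t x ≤ om t x) := by
    refine down_ind hT _ ?_ ?_
    · have ht : T - 1 < T := by omega
      have hHC : H (T - 1) = C (T - 1) := funext hHT1
      have hV' := hV (T - 1) ht
      rw [hHC, hST1] at hV'
      have hg := good_base (hCconv _ ht) (hK0 _ ht) (hCmin _ ht) hsT1a hsT1b
      have hHs : ∀ y, Hstar (T - 1) y = C (T - 1) y := by
        intro y
        rw [hHstar _ ht, show T - 1 + 1 = T by omega]
        simp [hVstarT]
      refine ⟨⟨?_, ?_, hIbarT1.le, ?_, ?_, ?_⟩, ?_, ?_⟩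
      · intro x w y _ _ _
        exact hg.Vconv hV' x w y trivial trivial trivial
      · intro x y _ _ h
        exact hg.Vle hV' trivial trivial h
      · exact phi_base (hγ _ ht) (hLip _ ht) hsT1b hV' hphiT1
      · exact phib_base hθ (hγ _ ht) (hLip _ ht) hsT1b hV' hphiT1 hphibT1
      · intro x y _; rw [hombT1, hombT1]
      · refine hleV _ ht fun x y hxy => ?_
        rw [hombT1, hHs, hV']
        have k0 := hK0 _ ht
        rcases eq_or_lt_of_le hxy with h | h
        · subst h
          simp only [lt_irrefl, if_false]
          split_ifs with hx
          · have := hg.below x trivial hx; linarith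
          · linarith
        · simp only [h, if_true]
          split_ifs with hx
          · have := hg.min y trivial; linarith
          · have := hg.c (z := x) (w := y) trivial trivial (by linarith) hxy
            linarith
      · intro x; rw [hHT1, hHs, homT1]; linarith
    · rintro t ht ⟨⟨hv, hvle, hIs, hφ, hφb, hob⟩, hind, -⟩
      have ht' : t < T := by omega
      have ht1 : t + 1 < T := by omega
      obtain ⟨n0, hn1, hn2⟩ : ∃ n0 : ℤ, (n0 : ℝ) * θ < Cm t ∧ Cm t ≤ ((n0 : ℝ) + 1) * θ := by
        refine ⟨⌈Cm t / θ⌉ - 1, ?_, ?_⟩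
        · rw [← lt_div_iff₀ hθ]; push_cast
          have := Int.ceil_lt_add_one (Cm t / θ); linarith
        · rw [← div_le_iff₀ hθ]; push_cast
          have := Int.le_ceil (Cm t / θ); linarith
      obtain ⟨hSUg, hCmSU, hCSU⟩ := (hSU t ht' n0 hn1 hn2).1
      obtain ⟨hg, hIbs, hsSU⟩ := good_step (hpos t) hθ hα0 (hK0 t ht') (hKmono t ht)
        (hCconv t ht') (hCmin t ht') ⟨n0, rfl⟩ hn1 (by linarith) hCmSU hCSU hv hvle
        (fun y hy => by rw [hV _ ht1, if_pos hy]) hIs (hHint t ht) (hI t ht) (hIbar t ht)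
        (hSdef t ht) (hsdef0 t ht) (hsdef1 t ht)
      have hψok := psi_ok (hpos t) hθ hα0 (hγ t ht') (hLip t ht') hφ (hVE _ ht1) (hphiE _ ht1)
        (hHint t ht) (hpsi t ht)
      have hψbok := psib_ok (hpos t) hθ hα0 (hγ t ht') (hLip t ht') hφb (hVE _ ht1) (hphiE _ ht1)
        (hphibE _ ht1 θ) (hHint t ht) (hpsi t ht) (hpsib t ht θ)
      obtain ⟨r1, r2⟩ := final_step (hpos t) hθ hα0 (hγ t ht') (hK0 t ht') (hKmono t ht)
        (hCconv t ht') (hLip t ht') (hCmin t ht') hn1 hCmSU hSUg hCSU (hVE _ ht1) (hVS _ ht1).1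
        (hVS _ ht1).2 hob (hombE _ ht1) hind hφ (hphiE _ ht1) hφb (hphibE _ ht1 θ) (hHint t ht)
        (hHstar t ht') (hpsi t ht) (hpsib t ht θ) (homint t ht) (heta t ht) (homb t ht) (hV t ht')
        hg hsSU
      exact ⟨⟨hg.Vconv (hV t ht'), fun x y hx hy h => hg.Vle (hV t ht') hx hy h, hIbs,
        phi_ok hψok hg.hs (hV t ht') (hphi t ht),
        phib_ok hθ hψok hψbok hg.Ps (hV t ht') (hphi t ht) (hphib t ht),
        omb_mono (om_mono (hpos t) hθ hα0 hψok hob (hombE _ ht1) (homint t ht)) (homb t ht)⟩,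
        hleV t ht' r2, r1⟩
  intro t ht x
  exact ⟨(main t ht).2.2 x, (main t ht).2.1 x⟩
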